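/- arXiv:0911.0737 — 2 statements merged into one kernel-verified Lean document; each statement's English description precedes it below -/
import Mathlib

section
/- Let M1 and M2 be random variables on a probability space with values in finite sets 𝒜1 and 𝒜2, and suppose S1 = g1(M1), S2 = g2(M2), S0 = g0(M1, M2) for functions g1, g2, g0 into finite sets. If |𝒜1| ≤ 2^{R1} and |𝒜2| ≤ 2^{R2} (so M1 can be described with R1 bits and M2 with R2 bits), then R1 ≥ H(S1), R2 ≥ H(S2), and R1 + R2 ≥ H(S1) + H(S2) + H(S0 | (S1, S2)), where entropies are in bits (base-2 logarithm). -/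
open MeasureTheory Filter
open scoped ENNReal

/-- Shannon entropy (base 2) of a finite-valued random variable `S` under `μ`. -/
noncomputable def shEntropy {Ω α : Type*} [MeasurableSpace Ω] (μ : Measure Ω)
    [Fintype α] (S : Ω → α) : ℝ :=
  -∑ s : α, ((μ (S ⁻¹' {s})).toReal * Real.logb 2 (μ (S ⁻¹' {s})).toReal)

/-- Conditional Shannon entropy (base 2) `H(S | T)` under `μ`. -/
noncomputable def shCondEntropy {Ω α β : Type*} [MeasurableSpace Ω] (μ : Measure Ω)
    [Fintype α] [Fintype β] (S : Ω → α) (T : Ω → β) : ℝ :=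
  shEntropy μ (fun ω => (S ω, T ω)) - shEntropy μ T

/-- Change of variables along `f` for the law of a finite-valued random variable. -/
theorem sum_law_mul_comp {Ω α β : Type*} [MeasurableSpace Ω] [Fintype α] [Fintype β]
    [MeasurableSpace α] [MeasurableSingletonClass α] (μ : Measure Ω) [IsFiniteMeasure μ]
    {X : Ω → α} (hX : Measurable X) (f : α → β) (h : β → ℝ) :
    ∑ a, μ.real (X ⁻¹' {a}) * h (f a) =
      ∑ b, μ.real ((fun ω => f (X ω)) ⁻¹' {b}) * h b := by
  classical
  rw [← Finset.sum_fiberwise Finset.univ f]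
  refine Finset.sum_congr rfl fun b _ => ?_
  have hset : (fun ω => f (X ω)) ⁻¹' {b} =
      X ⁻¹' ↑(Finset.univ.filter fun a => f a = b) := by
    ext ω; simp
  rw [hset, ← sum_measureReal_preimage_singleton _
    fun a _ => hX (measurableSet_singleton a), Finset.sum_mul]
  refine Finset.sum_congr rfl fun a ha => ?_
  rw [(Finset.mem_filter.mp ha).2]

theorem sum_law_eq_one {Ω α : Type*} [MeasurableSpace Ω] [Fintype α]
    [MeasurableSpace α] [MeasurableSingletonClass α] (μ : Measure Ω) [IsProbabilityMeasure μ]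
    {X : Ω → α} (hX : Measurable X) : ∑ a, μ.real (X ⁻¹' {a}) = 1 := by
  rw [sum_measureReal_preimage_singleton _ fun a _ => hX (measurableSet_singleton a)]
  simp

theorem shEntropy_comp {Ω α β : Type*} [MeasurableSpace Ω] [Fintype α] [Fintype β]
    [MeasurableSpace α] [MeasurableSingletonClass α] (μ : Measure Ω) [IsFiniteMeasure μ]
    {X : Ω → α} (hX : Measurable X) (f : α → β) :
    shEntropy μ (fun ω => f (X ω)) = -∑ a, μ.real (X ⁻¹' {a}) *
      Real.logb 2 (μ.real ((fun ω => f (X ω)) ⁻¹' {f a})) := by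
  rw [sum_law_mul_comp μ hX f
    fun b => Real.logb 2 (μ.real ((fun ω => f (X ω)) ⁻¹' {b}))]
  rfl

/-- **Gibbs' inequality**, base 2. -/
theorem sum_mul_logb_le_sum_mul_logb {α : Type*} [Fintype α] (p q : α → ℝ)
    (hp : ∀ a, 0 ≤ p a) (hq : ∀ a, 0 ≤ q a) (hpq : ∀ a, 0 < p a → 0 < q a)
    (hsum : ∑ a, q a ≤ ∑ a, p a) :
    ∑ a, p a * Real.logb 2 (q a) ≤ ∑ a, p a * Real.logb 2 (p a) := by
  have hterm : ∀ a, p a * Real.log (q a) - p a * Real.log (p a) ≤ q a - p a := fun a => by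
    rcases (hp a).eq_or_lt with h0 | hpos
    · simpa [← h0] using hq a
    · have hlog := Real.log_le_sub_one_of_pos (div_pos (hpq a hpos) hpos)
      rw [Real.log_div (hpq a hpos).ne' hpos.ne'] at hlog
      calc p a * Real.log (q a) - p a * Real.log (p a)
          = p a * (Real.log (q a) - Real.log (p a)) := by ring
        _ ≤ p a * (q a / p a - 1) := by gcongr
        _ = q a - p a := by field_simp
  have hlog : ∑ a, p a * Real.log (q a) ≤ ∑ a, p a * Real.log (p a) := by
    have := Finset.sum_le_sum fun a (_ : a ∈ Finset.univ) => hterm a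
    simp only [Finset.sum_sub_distrib] at this
    linarith
  simp only [Real.logb, ← mul_div_assoc, ← Finset.sum_div]
  exact div_le_div_of_nonneg_right hlog (Real.log_nonneg one_le_two)

theorem law_le_law_comp {Ω α β : Type*} [MeasurableSpace Ω] (μ : Measure Ω)
    [IsFiniteMeasure μ] (X : Ω → α) (f : α → β) (a : α) :
    μ.real (X ⁻¹' {a}) ≤ μ.real ((fun ω => f (X ω)) ⁻¹' {f a}) :=
  measureReal_mono fun ω (hω : X ω = a) => congrArg f hω

theorem shEntropy_comp_le {Ω α β : Type*} [MeasurableSpace Ω] [Fintype α] [Fintype β]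
    [MeasurableSpace α] [MeasurableSingletonClass α] (μ : Measure Ω) [IsFiniteMeasure μ]
    {X : Ω → α} (hX : Measurable X) (f : α → β) :
    shEntropy μ (fun ω => f (X ω)) ≤ shEntropy μ X := by
  rw [shEntropy_comp μ hX f]
  refine neg_le_neg (Finset.sum_le_sum fun a _ => ?_)
  change μ.real (X ⁻¹' {a}) * Real.logb 2 (μ.real (X ⁻¹' {a})) ≤ _
  rcases (measureReal_nonneg (μ := μ) (s := X ⁻¹' {a})).eq_or_lt with h0 | hpos
  · simp [← h0]
  · exact mul_le_mul_of_nonneg_left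
      (Real.logb_le_logb_of_le one_lt_two hpos (law_le_law_comp μ X f a)) hpos.le

theorem shEntropy_le_logb_card {Ω α : Type*} [MeasurableSpace Ω] [Fintype α]
    [MeasurableSpace α] [MeasurableSingletonClass α] (μ : Measure Ω) [IsProbabilityMeasure μ]
    {X : Ω → α} (hX : Measurable X) : shEntropy μ X ≤ Real.logb 2 (Fintype.card α) := by
  have : Nonempty α := μ.nonempty_of_neZero.map X
  have hcard : (0 : ℝ) < Fintype.card α := by exact_mod_cast Fintype.card_pos
  have hgibbs := sum_mul_logb_le_sum_mul_logb (fun a => μ.real (X ⁻¹' {a}))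
    (fun _ => (Fintype.card α : ℝ)⁻¹) (fun _ => measureReal_nonneg)
    (fun _ => by positivity) (fun _ _ => by positivity)
    (by simp [sum_law_eq_one μ hX, hcard.ne'])
  rw [← Finset.sum_mul, sum_law_eq_one μ hX, one_mul, Real.logb_inv] at hgibbs
  exact neg_le.mp hgibbs

/-- Data processing: applying functions to `X` and `Y` does not increase their mutual
information. -/
theorem shEntropy_mutualInfo_comp_le {Ω α β γ δ : Type*} [MeasurableSpace Ω]
    [Fintype α] [Fintype β] [Fintype γ] [Fintype δ]
    [MeasurableSpace α] [MeasurableSingletonClass α]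
    [MeasurableSpace β] [MeasurableSingletonClass β]
    (μ : Measure Ω) [IsProbabilityMeasure μ]
    {X : Ω → α} {Y : Ω → β} (hX : Measurable X) (hY : Measurable Y)
    (f : α → γ) (g : β → δ) :
    shEntropy μ (fun ω => f (X ω)) + shEntropy μ (fun ω => g (Y ω)) -
        shEntropy μ (fun ω => (f (X ω), g (Y ω))) ≤
      shEntropy μ X + shEntropy μ Y - shEntropy μ (fun ω => (X ω, Y ω)) := by
  have hXY : Measurable fun ω => (X ω, Y ω) := hX.prodMk hY
  let p : α × β → ℝ := fun z => μ.real ((fun ω => (X ω, Y ω)) ⁻¹' {z})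
  let pX : α → ℝ := fun a => μ.real (X ⁻¹' {a})
  let pY : β → ℝ := fun b => μ.real (Y ⁻¹' {b})
  let pf : γ → ℝ := fun c => μ.real ((fun ω => f (X ω)) ⁻¹' {c})
  let pg : δ → ℝ := fun d => μ.real ((fun ω => g (Y ω)) ⁻¹' {d})
  let pfg : γ × δ → ℝ := fun z => μ.real ((fun ω => (f (X ω), g (Y ω))) ⁻¹' {z})
  let q : α × β → ℝ := fun z =>
    pX z.1 * (pY z.2 * (pfg (f z.1, g z.2) / (pf (f z.1) * pg (g z.2))))
  have hq : ∀ z, 0 ≤ q z := fun z => by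
    simp only [q, pX, pY, pf, pg, pfg]; positivity
  have hpos : ∀ z, 0 < p z → 0 < pX z.1 ∧ 0 < pY z.2 ∧ 0 < pf (f z.1) ∧
      0 < pg (g z.2) ∧ 0 < pfg (f z.1, g z.2) := fun z hz =>
    ⟨hz.trans_le (law_le_law_comp μ _ Prod.fst z),
      hz.trans_le (law_le_law_comp μ _ Prod.snd z),
      hz.trans_le (law_le_law_comp μ _ (fun w => f w.1) z),
      hz.trans_le (law_le_law_comp μ _ (fun w => g w.2) z),
      hz.trans_le (law_le_law_comp μ _ (fun w => (f w.1, g w.2)) z)⟩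
  have hsum : ∑ z, q z ≤ ∑ z, p z := by
    calc ∑ z, q z
        = ∑ a, pX a * ∑ b, pY b * (pfg (f a, g b) / (pf (f a) * pg (g b))) := by
          simp only [q, Fintype.sum_prod_type, Finset.mul_sum]
      _ = ∑ a, pX a * ∑ d, pg d * (pfg (f a, d) / (pf (f a) * pg d)) :=
          Finset.sum_congr rfl fun a _ => congrArg (pX a * ·) <|
            sum_law_mul_comp μ hY g fun d => pfg (f a, d) / (pf (f a) * pg d)
      _ = ∑ c, pf c * ∑ d, pg d * (pfg (c, d) / (pf c * pg d)) :=
          sum_law_mul_comp μ hX f fun c => ∑ d, pg d * (pfg (c, d) / (pf c * pg d))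
      _ = ∑ z : γ × δ, (pf z.1 * pg z.2) * (pfg z / (pf z.1 * pg z.2)) := by
          simp only [Fintype.sum_prod_type, Finset.mul_sum, mul_assoc]
      _ ≤ ∑ z, pfg z := Finset.sum_le_sum fun z _ => by
          by_cases h0 : pf z.1 * pg z.2 = 0
          · rw [h0, zero_mul]; exact measureReal_nonneg
          · exact (mul_div_cancel₀ _ h0).le
      _ = ∑ z, p z := by
          simpa using (sum_law_mul_comp μ hXY (fun w => (f w.1, g w.2)) fun _ => 1).symm
  have hgibbs := sum_mul_logb_le_sum_mul_logb p q (fun _ => measureReal_nonneg) hq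
    (fun z hz => by
      obtain ⟨h1, h2, h3, h4, h5⟩ := hpos z hz
      simp only [q]; positivity) hsum
  have hexpand : ∑ z, p z * Real.logb 2 (q z) =
      ∑ z, p z * Real.logb 2 (pX z.1) + ∑ z, p z * Real.logb 2 (pY z.2) +
      ∑ z, p z * Real.logb 2 (pfg (f z.1, g z.2)) -
      ∑ z, p z * Real.logb 2 (pf (f z.1)) - ∑ z, p z * Real.logb 2 (pg (g z.2)) := by
    simp only [← Finset.sum_add_distrib, ← Finset.sum_sub_distrib]
    refine Finset.sum_congr rfl fun z _ => ?_
    have hp : 0 ≤ p z := measureReal_nonneg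
    rcases hp.eq_or_lt with h0 | hz
    · simp [← h0]
    · obtain ⟨h1, h2, h3, h4, h5⟩ := hpos z hz
      simp only [q]
      rw [Real.logb_mul h1.ne' (by positivity), Real.logb_mul h2.ne' (by positivity),
        Real.logb_div h5.ne' (by positivity), Real.logb_mul h3.ne' h4.ne']
      ring
  have eX : shEntropy μ X = -∑ z, p z * Real.logb 2 (pX z.1) :=
    shEntropy_comp μ hXY Prod.fst
  have eY : shEntropy μ Y = -∑ z, p z * Real.logb 2 (pY z.2) :=
    shEntropy_comp μ hXY Prod.snd
  have ef : shEntropy μ (fun ω => f (X ω)) = -∑ z, p z * Real.logb 2 (pf (f z.1)) :=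
    shEntropy_comp μ hXY fun w => f w.1
  have eg : shEntropy μ (fun ω => g (Y ω)) = -∑ z, p z * Real.logb 2 (pg (g z.2)) :=
    shEntropy_comp μ hXY fun w => g w.2
  have efg : shEntropy μ (fun ω => (f (X ω), g (Y ω))) =
      -∑ z, p z * Real.logb 2 (pfg (f z.1, g z.2)) :=
    shEntropy_comp μ hXY fun w => (f w.1, g w.2)
  have eXY : shEntropy μ (fun ω => (X ω, Y ω)) = -∑ z, p z * Real.logb 2 (p z) := rfl
  linarith

theorem shEntropy_le_of_card_le {Ω α : Type*} [MeasurableSpace Ω] [Fintype α]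
    [MeasurableSpace α] [MeasurableSingletonClass α] (μ : Measure Ω) [IsProbabilityMeasure μ]
    {X : Ω → α} (hX : Measurable X) {R : ℝ} (hR : (Fintype.card α : ℝ) ≤ 2 ^ R) :
    shEntropy μ X ≤ R := by
  have : Nonempty α := μ.nonempty_of_neZero.map X
  refine (shEntropy_le_logb_card μ hX).trans ?_
  rwa [Real.logb_le_iff_le_rpow one_lt_two (by exact_mod_cast Fintype.card_pos)]

/-- **Theorem 1 of the paper.** If `M1` can be described with `R1` bits and `M2` with
`R2` bits, and `S1 = g1(M1)`, `S2 = g2(M2)`, `S0 = g0(M1, M2)`, then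
`R1 ≥ H(S1)`, `R2 ≥ H(S2)` and `R1 + R2 ≥ H(S1) + H(S2) + H(S0 | (S1, S2))`. -/
theorem md_zero_error_rate_bounds {Ω A1 A2 S1t S2t S0t : Type*} [MeasurableSpace Ω]
    [Fintype A1] [Fintype A2] [Fintype S1t] [Fintype S2t] [Fintype S0t]
    [MeasurableSpace A1] [MeasurableSingletonClass A1]
    [MeasurableSpace A2] [MeasurableSingletonClass A2]
    (μ : Measure Ω) [IsProbabilityMeasure μ]
    (M1 : Ω → A1) (M2 : Ω → A2) (hM1 : Measurable M1) (hM2 : Measurable M2)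
    (g1 : A1 → S1t) (g2 : A2 → S2t) (g0 : A1 × A2 → S0t)
    (R1 R2 : ℝ)
    (hR1 : (Fintype.card A1 : ℝ) ≤ 2 ^ R1)
    (hR2 : (Fintype.card A2 : ℝ) ≤ 2 ^ R2) :
    shEntropy μ (fun ω => g1 (M1 ω)) ≤ R1 ∧
    shEntropy μ (fun ω => g2 (M2 ω)) ≤ R2 ∧
    shEntropy μ (fun ω => g1 (M1 ω)) + shEntropy μ (fun ω => g2 (M2 ω)) +
      shCondEntropy μ (fun ω => g0 (M1 ω, M2 ω))
        (fun ω => (g1 (M1 ω), g2 (M2 ω))) ≤ R1 + R2 := by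
  have h1 := shEntropy_le_of_card_le μ hM1 hR1
  have h2 := shEntropy_le_of_card_le μ hM2 hR2
  refine ⟨(shEntropy_comp_le μ hM1 g1).trans h1, (shEntropy_comp_le μ hM2 g2).trans h2, ?_⟩
  have hinfo := shEntropy_mutualInfo_comp_le μ hM1 hM2 g1 g2
  have htriple := shEntropy_comp_le μ (hM1.prodMk hM2) fun m => (g0 m, (g1 m.1, g2 m.2))
  unfold shCondEntropy
  linarith
end

section
/- Let M1 and M2 be random variables on a probability space with values in finite sets, and suppose S1 = g1(M1) and S2 = g2(M2) for functions g1, g2 into finite sets. Then H(M1) + H(M2) ≥ H(S1) + H(S2) + H((M1, M2) | (S1, S2)). -/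
open MeasureTheory Filter
open scoped ENNReal

/-- Change of variables for a function of a finite-valued random variable. -/
theorem sum_measureReal_preimage_comp {Ω α β : Type*} [MeasurableSpace Ω]
    [Fintype α] [Fintype β] [MeasurableSpace α] [MeasurableSingletonClass α]
    (μ : Measure Ω) [IsFiniteMeasure μ] {X : Ω → α} (hX : Measurable X)
    (f : α → β) (φ : β → ℝ) :
    ∑ a, μ.real (X ⁻¹' {a}) * φ (f a) =
      ∑ b, μ.real ((fun ω => f (X ω)) ⁻¹' {b}) * φ b := by
  classical
  rw [← Finset.sum_fiberwise Finset.univ f]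
  refine Finset.sum_congr rfl fun b _ => ?_
  have h : μ.real ((fun ω => f (X ω)) ⁻¹' {b}) =
      ∑ a ∈ Finset.univ.filter (fun a => f a = b), μ.real (X ⁻¹' {a}) := by
    rw [sum_measureReal_preimage_singleton _ fun a _ => hX (measurableSet_singleton a)]
    congr 1
    ext ω
    simp
  rw [h, Finset.sum_mul]
  refine Finset.sum_congr rfl fun a ha => ?_
  rw [(Finset.mem_filter.1 ha).2]

/-- The tangent-line bound for the logarithm, applied to a ratio of probabilities. -/
theorem mul_logb_ratio_le {p x y z u v : ℝ} (hp : 0 ≤ p) (hx : p ≤ x) (hy : p ≤ y)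
    (hz : p ≤ z) (hu : p ≤ u) (hv : p ≤ v) :
    p * (Real.logb 2 x + Real.logb 2 y + Real.logb 2 z
        - Real.logb 2 p - Real.logb 2 u - Real.logb 2 v) ≤
      (x * y * (z / (u * v)) - p) / Real.log 2 := by
  have h2 : 0 < Real.log 2 := Real.log_pos one_lt_two
  rcases hp.eq_or_lt with rfl | hp
  · rw [zero_mul, sub_zero]
    positivity
  have hx0 := hp.trans_le hx
  have hy0 := hp.trans_le hy
  have hz0 := hp.trans_le hz
  have hu0 := hp.trans_le hu
  have hv0 := hp.trans_le hv
  have hlog := Real.log_le_sub_one_of_pos (x := x * y * z / (p * u * v)) (by positivity)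
  rw [Real.log_div (by positivity) (by positivity), Real.log_mul (by positivity) hz0.ne',
    Real.log_mul hx0.ne' hy0.ne', Real.log_mul (by positivity) hv0.ne',
    Real.log_mul hp.ne' hu0.ne'] at hlog
  have hmul := mul_le_mul_of_nonneg_left hlog hp.le
  have hsimp : p * (x * y * z / (p * u * v) - 1) = x * y * (z / (u * v)) - p := by
    field_simp
  rw [hsimp] at hmul
  simp only [Real.logb]
  rw [le_div_iff₀ h2]
  refine le_trans (le_of_eq ?_) hmul
  field_simp
  ring

/-- Summing a coupling against ratios to the product of its marginals gives at most one. -/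
theorem sum_mul_mul_div_le_one {Ω α β γ δ : Type*} [MeasurableSpace Ω]
    [Fintype α] [Fintype β] [Fintype γ] [Fintype δ]
    [MeasurableSpace α] [MeasurableSingletonClass α]
    [MeasurableSpace β] [MeasurableSingletonClass β]
    (μ : Measure Ω) [IsProbabilityMeasure μ] {X : Ω → α} {Y : Ω → β}
    (hX : Measurable X) (hY : Measurable Y) (f : α → γ) (g : β → δ) :
    ∑ a : α × β, μ.real (X ⁻¹' {a.1}) * μ.real (Y ⁻¹' {a.2}) *
      (μ.real ((fun ω => (f (X ω), g (Y ω))) ⁻¹' {(f a.1, g a.2)}) /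
        (μ.real ((fun ω => f (X ω)) ⁻¹' {f a.1}) *
          μ.real ((fun ω => g (Y ω)) ⁻¹' {g a.2}))) ≤ 1 := by
  set q : γ → δ → ℝ := fun s t => μ.real ((fun ω => (f (X ω), g (Y ω))) ⁻¹' {(s, t)})
  set u : γ → ℝ := fun s => μ.real ((fun ω => f (X ω)) ⁻¹' {s})
  set v : δ → ℝ := fun t => μ.real ((fun ω => g (Y ω)) ⁻¹' {t})
  calc _ = ∑ a, μ.real (X ⁻¹' {a}) * ∑ b, μ.real (Y ⁻¹' {b}) *
          (q (f a) (g b) / (u (f a) * v (g b))) := by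
        simp only [Fintype.sum_prod_type, Finset.mul_sum, mul_assoc]
        rfl
    _ = ∑ s, u s * ∑ t, v t * (q s t / (u s * v t)) := by
        rw [← sum_measureReal_preimage_comp μ hX f
          (fun s => ∑ t, v t * (q s t / (u s * v t)))]
        refine Finset.sum_congr rfl fun a _ => ?_
        rw [sum_measureReal_preimage_comp μ hY g (fun t => q (f a) t / (u (f a) * v t))]
    _ ≤ ∑ s, ∑ t, q s t := by
        simp only [Finset.mul_sum]
        refine Finset.sum_le_sum fun s _ => Finset.sum_le_sum fun t _ => ?_
        have hq : 0 ≤ q s t := measureReal_nonneg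
        rw [← mul_assoc, mul_div_left_comm]
        exact mul_le_of_le_one_right hq (div_self_le_one _)
    _ = ∑ a : α × β, μ.real ((fun ω => (X ω, Y ω)) ⁻¹' {a}) := by
        have h := sum_measureReal_preimage_comp μ (hX.prodMk hY)
          (fun a => (f a.1, g a.2)) (fun _ => 1)
        simp only [mul_one] at h
        rw [h, Fintype.sum_prod_type]
    _ ≤ 1 := by
        rw [sum_measureReal_preimage_singleton _
          fun a _ => (hX.prodMk hY) (measurableSet_singleton a)]
        exact measureReal_le_one

/-- Key chain of inequalities in the proof of the paper's Theorem 1: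
`H(M1) + H(M2) ≥ H(S1) + H(S2) + H((M1, M2) | (S1, S2))`
for `S1 = g1(M1)` and `S2 = g2(M2)`. -/
theorem entropy_sum_ge_reconstruction_entropies {Ω A1 A2 S1t S2t : Type*} [MeasurableSpace Ω]
    [Fintype A1] [Fintype A2] [Fintype S1t] [Fintype S2t]
    [MeasurableSpace A1] [MeasurableSingletonClass A1]
    [MeasurableSpace A2] [MeasurableSingletonClass A2]
    (μ : Measure Ω) [IsProbabilityMeasure μ]
    (M1 : Ω → A1) (M2 : Ω → A2) (hM1 : Measurable M1) (hM2 : Measurable M2)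
    (g1 : A1 → S1t) (g2 : A2 → S2t) :
    shEntropy μ (fun ω => g1 (M1 ω)) + shEntropy μ (fun ω => g2 (M2 ω)) +
      shCondEntropy μ (fun ω => (M1 ω, M2 ω))
        (fun ω => (g1 (M1 ω), g2 (M2 ω)))
      ≤ shEntropy μ M1 + shEntropy μ M2 := by
  have hM : Measurable fun ω => (M1 ω, M2 ω) := hM1.prodMk hM2
  have hpair (a : A1 × A2) :
      (fun ω => ((M1 ω, M2 ω), (g1 (M1 ω), g2 (M2 ω)))) ⁻¹' {(a, (g1 a.1, g2 a.2))} =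
        (fun ω => (M1 ω, M2 ω)) ⁻¹' {a} := by
    ext ω
    simp only [Set.mem_preimage, Set.mem_singleton_iff, Prod.ext_iff]
    grind
  have hS1 := shEntropy_comp μ hM fun a => g1 a.1
  have hS2 := shEntropy_comp μ hM fun a => g2 a.2
  have hS := shEntropy_comp μ hM fun a => (g1 a.1, g2 a.2)
  have hMS := shEntropy_comp μ hM fun a => (a, (g1 a.1, g2 a.2))
  have hM1' := shEntropy_comp μ hM Prod.fst
  have hM2' := shEntropy_comp μ hM Prod.snd
  simp only [hpair] at hMS
  have hle (a : A1 × A2) {s : Set Ω} (hs : (fun ω => (M1 ω, M2 ω)) ⁻¹' {a} ⊆ s) :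
      μ.real ((fun ω => (M1 ω, M2 ω)) ⁻¹' {a}) ≤ μ.real s := measureReal_mono hs
  have hbound := Finset.sum_le_sum fun (a : A1 × A2) (_ : a ∈ Finset.univ) =>
    mul_logb_ratio_le (p := μ.real ((fun ω => (M1 ω, M2 ω)) ⁻¹' {a})) measureReal_nonneg
      (hle a (s := M1 ⁻¹' {a.1}) (by rintro ω rfl; rfl))
      (hle a (s := M2 ⁻¹' {a.2}) (by rintro ω rfl; rfl))
      (hle a (s := (fun ω => (g1 (M1 ω), g2 (M2 ω))) ⁻¹' {(g1 a.1, g2 a.2)})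
        (by rintro ω rfl; rfl))
      (hle a (s := (fun ω => g1 (M1 ω)) ⁻¹' {g1 a.1}) (by rintro ω rfl; rfl))
      (hle a (s := (fun ω => g2 (M2 ω)) ⁻¹' {g2 a.2}) (by rintro ω rfl; rfl))
  have htotal : ∑ a : A1 × A2, μ.real ((fun ω => (M1 ω, M2 ω)) ⁻¹' {a}) = 1 := by
    rw [sum_measureReal_preimage_singleton _ fun a _ => hM (measurableSet_singleton a)]
    simp
  have hnonpos := div_nonpos_of_nonpos_of_nonneg
    (sub_nonpos.2 (sum_mul_mul_div_le_one μ hM1 hM2 g1 g2)) (Real.log_nonneg one_le_two)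
  rw [← Finset.sum_div, Finset.sum_sub_distrib, htotal] at hbound
  have hsum := hbound.trans hnonpos
  simp only [mul_sub, mul_add, Finset.sum_sub_distrib, Finset.sum_add_distrib] at hsum
  rw [shCondEntropy, hS1, hS2, hS, hMS]
  change _ ≤ shEntropy μ (fun ω => M1 ω) + shEntropy μ (fun ω => M2 ω)
  rw [hM1', hM2']
  linarith
end
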